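/- Let n ≥ 1, let a ∈ ℝ^n, and suppose there exist ϑ ∈ ℝ∖{0} and a subfield F ⊆ ℝ with [F : ℚ] = n such that ϑa_1,…,ϑa_n all lie in F and form a basis of F as a ℚ-vector space. Suppose the multiplier group M_a contains an element different from 1 and −1. Let B ∈ M(n,ℤ) with det B ≠ 0 and set b = Ba. Then the multiplier group M_b also contains an element different from 1 and −1. -/

import Mathlib

noncomputable section

/-- Euclidean space `ℝ^n`. -/
abbrev Eucl (n : ℕ) := Fin n → ℝ

/-- The inclusion of the integer lattice `ℤ^n` into `ℝ^n`. -/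
def intVec {n : ℕ} (m : Fin n → ℤ) : Eucl n := fun i => (m i : ℝ)

/-- The integer lattice `ℤ^n` as an additive subgroup of `ℝ^n`. -/
def intLattice (n : ℕ) : AddSubgroup (Eucl n) where
  carrier := Set.range (intVec (n := n))
  add_mem' := by
    rintro _ _ ⟨p, rfl⟩ ⟨q, rfl⟩
    exact ⟨p + q, by funext i; simp [intVec]⟩
  zero_mem' := ⟨0, by funext i; simp [intVec]⟩
  neg_mem' := by
    rintro _ ⟨p, rfl⟩
    exact ⟨-p, by funext i; simp [intVec]⟩

/-- The `n`-torus `T^n = ℝ^n / ℤ^n`. -/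
abbrev Torus (n : ℕ) := Eucl n ⧸ intLattice n

/-- The covering projection `π : ℝ^n → T^n`. -/
def torusPi (n : ℕ) : Eucl n → Torus n := QuotientAddGroup.mk

/-- `W : ℝ^n → ℝ^n` is a lift of `V : T^n → T^n`, i.e. `V ∘ π = π ∘ W`. -/
def IsLift {n : ℕ} (V : Torus n → Torus n) (W : Eucl n → Eucl n) : Prop :=
  ∀ x, V (torusPi n x) = torusPi n (W x)

/-- An integer matrix viewed as a real matrix. -/
def matR {n : ℕ} (B : Matrix (Fin n) (Fin n) ℤ) : Matrix (Fin n) (Fin n) ℝ :=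
  B.map Int.cast

/-- `W` is a `C^∞` diffeomorphism of `ℝ^n`. -/
def SmoothDiffeoR {n : ℕ} (W : Eucl n → Eucl n) : Prop :=
  ContDiff ℝ (⊤ : ℕ∞) W ∧ ∃ W' : Eucl n → Eucl n, ContDiff ℝ (⊤ : ℕ∞) W' ∧
    Function.LeftInverse W' W ∧ Function.RightInverse W' W

/-- The components of `a ∈ ℝ^n` are linearly independent over `ℚ`. -/
def QIndep {n : ℕ} (a : Eucl n) : Prop := LinearIndependent ℚ a

/-- `R` is a generalized symmetry, with multiplier `α`, of the flow on `T^n` generated by the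
constant vector field `a`: `R` is a diffeomorphism of the torus (a bijection admitting a smooth
diffeomorphism lift) and a lift `R̂` satisfies `(DR̂(x))a = αa` for all `x`. -/
def IsGenSym {n : ℕ} (a : Eucl n) (α : ℝ) (R : Torus n → Torus n) : Prop :=
  Function.Bijective R ∧ ∃ Rh : Eucl n → Eucl n, IsLift R Rh ∧ SmoothDiffeoR Rh ∧
    ∀ x, fderiv ℝ Rh x a = α • a

/-- The multiplier group `M_a ⊆ ℝ \ {0}` of the flow generated by the constant vector field `a`. -/
def Mgroup {n : ℕ} (a : Eucl n) : Set ℝ :=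
  {α | α ≠ 0 ∧ ∃ R : Torus n → Torus n, IsGenSym a α R}

/-- The flow generated by the constant vector field `a` is smoothly semiconjugate to the flow
generated by the constant vector field `b` by the surjective map `V : T^n → T^n`: `V` admits a
`C^∞` lift `W` with `(DW(x))a = b` for all `x`. -/
def SmoothSemiconj {n : ℕ} (a b : Eucl n) (V : Torus n → Torus n) : Prop :=
  Function.Surjective V ∧ ∃ W : Eucl n → Eucl n, IsLift V W ∧ ContDiff ℝ (⊤ : ℕ∞) W ∧
    ∀ x, fderiv ℝ W x a = b

/-- The numbers `ϑ * a 1, …, ϑ * a n` all lie in the subfield `F` of `ℝ` and form a basis of `F`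
as a vector space over `ℚ`. -/
def IsAlgebraicFreq {n : ℕ} (a : Eucl n) (ϑ : ℝ) (F : Subfield ℝ) : Prop :=
  (∀ i, ϑ * a i ∈ F) ∧ LinearIndependent ℚ (fun i => ϑ * a i) ∧
    ∀ y ∈ F, ∃ q : Fin n → ℚ, y = ∑ i, (q i : ℝ) * (ϑ * a i)

theorem mem_intLattice {n : ℕ} {x : Eucl n} : x ∈ intLattice n ↔ ∃ m, intVec m = x :=
  Iff.rfl

theorem torusPi_eq_iff {n : ℕ} {x y : Eucl n} :
    torusPi n x = torusPi n y ↔ ∃ m, y = x + intVec m := by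
  rw [torusPi, QuotientAddGroup.eq, mem_intLattice]
  refine exists_congr fun m => ?_
  rw [eq_neg_add_iff_add_eq, eq_comm]

theorem torusPi_surjective (n : ℕ) : Function.Surjective (torusPi n) :=
  QuotientAddGroup.mk_surjective

theorem intVec_add {n : ℕ} (p q : Fin n → ℤ) : intVec (p + q) = intVec p + intVec q := by
  funext i; simp [intVec]

theorem intVec_injective {n : ℕ} : Function.Injective (intVec (n := n)) := fun p q h => by
  funext i
  exact Int.cast_injective (congrFun h i)

theorem intVec_mulVec {n : ℕ} (A : Matrix (Fin n) (Fin n) ℤ) (m : Fin n → ℤ) :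
    intVec (A.mulVec m) = (matR A).mulVec (intVec m) := by
  funext i
  simp [intVec, matR, Matrix.mulVec, dotProduct]

theorem matR_mul {n : ℕ} (A B : Matrix (Fin n) (Fin n) ℤ) : matR (A * B) = matR A * matR B :=
  Matrix.map_mul_intCast A B

theorem matR_one {n : ℕ} : matR (1 : Matrix (Fin n) (Fin n) ℤ) = 1 := by
  simp [matR]

theorem exists_intVec_const {n : ℕ} {g : Eucl n → Eucl n} (hg : Continuous g)
    (h : ∀ x, ∃ m, g x = intVec m) : ∃ m, ∀ x, g x = intVec m := by
  choose k hk using h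
  refine ⟨k 0, fun x => ?_⟩
  rw [hk x]
  congr 1
  funext i
  have hc : Continuous fun x => k x i := by
    rw [Int.isClosedEmbedding_coe_real.isEmbedding.continuous_iff]
    have : (Int.cast ∘ fun x => k x i) = fun x => g x i := by
      funext x; rw [hk x]; rfl
    rw [this]
    exact (continuous_apply i).comp hg
  exact PreconnectedSpace.constant inferInstance hc

/-- A continuous lift of a torus map is equivariant with respect to an integer matrix. -/
theorem IsLift.exists_matrix {n : ℕ} {V : Torus n → Torus n} {W : Eucl n → Eucl n}
    (h : IsLift V W) (hW : Continuous W) :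
    ∃ A : Matrix (Fin n) (Fin n) ℤ, ∀ x m, W (x + intVec m) = W x + intVec (A.mulVec m) := by
  have key : ∀ m : Fin n → ℤ, ∃ p, ∀ x, W (x + intVec m) - W x = intVec p := fun m => by
    refine exists_intVec_const (by fun_prop) fun x => ?_
    have hx : torusPi n x = torusPi n (x + intVec m) := torusPi_eq_iff.2 ⟨m, rfl⟩
    obtain ⟨p, hp⟩ := torusPi_eq_iff.1 ((h x).symm.trans ((congrArg V hx).trans (h _)))
    exact ⟨p, by rw [hp, add_sub_cancel_left]⟩
  choose f hf using key
  let φ : (Fin n → ℤ) →+ (Fin n → ℤ) := AddMonoidHom.mk' f fun p q => by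
    apply intVec_injective
    rw [intVec_add, ← hf (p + q) 0, ← hf q 0, ← hf p (0 + intVec q), intVec_add,
      add_comm (intVec p), ← add_assoc]
    abel
  refine ⟨LinearMap.toMatrix' φ.toIntLinearMap, fun x m => ?_⟩
  rw [LinearMap.toMatrix'_mulVec]
  exact sub_eq_iff_eq_add'.1 (hf m x)

theorem eq_zero_of_forall_nat_mul_le {c C : ℝ} (h : ∀ N : ℕ, |N * c| ≤ C) : c = 0 := by
  by_contra hc
  obtain ⟨N, hN⟩ := exists_nat_gt (C / |c|)
  have := h N
  rw [abs_mul, Nat.abs_cast] at this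
  rw [div_lt_iff₀ (abs_pos.2 hc)] at hN
  linarith

theorem apply_smul_of_fderiv_eq {n : ℕ} {W : Eucl n → Eucl n} (hW : Differentiable ℝ W)
    {a v : Eucl n} (h : ∀ x, fderiv ℝ W x a = v) (t : ℝ) : W (t • a) = W 0 + t • v := by
  have hd : ∀ s : ℝ, HasDerivAt (fun s : ℝ => W (s • a) - s • v) 0 s := fun s => by
    have h1 : HasDerivAt (fun s : ℝ => s • a) a s := by
      simpa using (hasDerivAt_id s).smul_const a
    have h2 : HasDerivAt (fun s : ℝ => s • v) v s := by
      simpa using (hasDerivAt_id s).smul_const v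
    have h3 := (hW (s • a)).hasFDerivAt.comp_hasDerivAt s h1
    rw [h] at h3
    exact sub_self v ▸ h3.sub h2
  have := is_const_of_deriv_eq_zero (fun s => (hd s).differentiableAt)
    (fun s => (hd s).deriv) t 0
  simp only [zero_smul, sub_zero] at this
  exact sub_eq_iff_eq_add.1 this

theorem mulVec_eq_of_fderiv_eq {n : ℕ} {W : Eucl n → Eucl n} (hW : Differentiable ℝ W)
    {A : Matrix (Fin n) (Fin n) ℤ} (hA : ∀ x m, W (x + intVec m) = W x + intVec (A.mulVec m))
    {a v : Eucl n} (h : ∀ x, fderiv ℝ W x a = v) : (matR A).mulVec a = v := by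
  let P : Eucl n → Eucl n := fun x => W x - (matR A).mulVec x - W 0
  have hP : Continuous P := by
    have := hW.continuous
    have h2 : Continuous fun x : Eucl n => (matR A).mulVec x :=
      continuous_const.matrix_mulVec continuous_id
    fun_prop
  obtain ⟨C, hC⟩ := (isCompact_Icc (a := (0 : Eucl n)) (b := 1)).exists_bound_of_continuousOn
    hP.continuousOn
  have hPa : ∀ x, ‖P x‖ ≤ C := fun x => by
    have hx : x = (fun i => Int.fract (x i)) + intVec fun i => ⌊x i⌋ := by
      funext i; simp [intVec]
    have hPx : P x = P fun i => Int.fract (x i) := by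
      conv_lhs => rw [hx]
      simp only [P]
      rw [hA, intVec_mulVec, Matrix.mulVec_add]
      abel
    rw [hPx]
    exact hC _ ⟨fun i => Int.fract_nonneg _, fun i => (Int.fract_lt_one _).le⟩
  rw [eq_comm, ← sub_eq_zero]
  funext i
  refine eq_zero_of_forall_nat_mul_le (C := C) fun N => ?_
  have hN := (norm_le_pi_norm _ i).trans (hPa ((N : ℝ) • a))
  have he : P ((N : ℝ) • a) = (N : ℝ) • (v - (matR A).mulVec a) := by
    simp only [P]
    rw [apply_smul_of_fderiv_eq hW h, Matrix.mulVec_smul, smul_sub]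
    abel
  rw [he] at hN
  simpa using hN

/-- A generalized symmetry acts on the first homology of the torus by a unimodular integer matrix
having the generating vector as an eigenvector. -/
theorem IsGenSym.exists_matrix {n : ℕ} {a : Eucl n} {α : ℝ} {R : Torus n → Torus n}
    (h : IsGenSym a α R) : ∃ A : Matrix (Fin n) (Fin n) ℤ, IsUnit A ∧
      (matR A).mulVec a = α • a := by
  obtain ⟨hR, W, hlift, ⟨hW, W', hW', hl, hr⟩, hD⟩ := h
  obtain ⟨S, hSR, -⟩ := Function.bijective_iff_has_inverse.1 hR
  have hlift' : IsLift S W' := fun y => by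
    rw [← hSR (torusPi n (W' y)), hlift, hr]
  obtain ⟨A, hA⟩ := hlift.exists_matrix hW.continuous
  obtain ⟨A', hA'⟩ := hlift'.exists_matrix hW'.continuous
  refine ⟨A, ?_, mulVec_eq_of_fderiv_eq (hW.differentiable (by simp)) hA hD⟩
  have hmul : A' * A = 1 := by
    refine Matrix.mulVec_injective (funext fun m => intVec_injective ?_)
    have := hl (0 + intVec m)
    rw [hA, hA', hl] at this
    simpa using this
  exact IsUnit.of_mul_eq_one_right A' hmul

/-- A unimodular integer matrix with eigenvector `a` induces a generalized symmetry. -/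
theorem mem_Mgroup_of_isUnit {n : ℕ} {a : Eucl n} {α : ℝ} (hα : α ≠ 0)
    {A : Matrix (Fin n) (Fin n) ℤ} (hA : IsUnit A) (h : (matR A).mulVec a = α • a) :
    α ∈ Mgroup a := by
  obtain ⟨⟨A, A', hAA', hA'A⟩, rfl⟩ := hA
  have hinv : ∀ {P Q : Matrix (Fin n) (Fin n) ℤ}, P * Q = 1 →
      ∀ x, (matR P).mulVec ((matR Q).mulVec x) = x := fun hPQ x => by
    rw [Matrix.mulVec_mulVec, ← matR_mul, hPQ, matR_one, Matrix.one_mulVec]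
  let ind (P : Matrix (Fin n) (Fin n) ℤ) : Torus n → Torus n :=
    Quotient.map' (matR P).mulVec fun x y hxy => by
      obtain ⟨m, rfl⟩ := torusPi_eq_iff.1 (Quotient.sound hxy)
      refine Quotient.exact (torusPi_eq_iff.2 ⟨P.mulVec m, ?_⟩)
      rw [intVec_mulVec, Matrix.mulVec_add]
  have hind : ∀ P, IsLift (ind P) (matR P).mulVec := fun P x => rfl
  have hind_inv : ∀ {P Q : Matrix (Fin n) (Fin n) ℤ}, P * Q = 1 →
      Function.LeftInverse (ind P) (ind Q) := fun hPQ y => by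
    obtain ⟨x, rfl⟩ := torusPi_surjective n y
    rw [hind, hind, hinv hPQ]
  have hsmooth : ∀ P : Matrix (Fin n) (Fin n) ℤ, ContDiff ℝ (⊤ : ℕ∞) (matR P).mulVec := fun P =>
    (Matrix.mulVecLin (matR P)).toContinuousLinearMap.contDiff
  refine ⟨hα, ind A, ⟨(hind_inv hA'A).injective, (hind_inv hAA').surjective⟩, (matR A).mulVec,
    hind A, ⟨hsmooth A, (matR A').mulVec, hsmooth A', hinv hA'A, hinv hAA'⟩, fun x => ?_⟩
  rw [← h]
  exact congrArg (· a) ((Matrix.mulVecLin (matR A)).toContinuousLinearMap.fderiv (x := x))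

/-- Some positive power of a unimodular integer matrix is congruent to `1` modulo `d`. -/
theorem exists_pow_eq_one_add_smul {n : ℕ} {A : Matrix (Fin n) (Fin n) ℤ} (hA : IsUnit A)
    {d : ℤ} (hd : d ≠ 0) :
    ∃ k : ℕ, k ≠ 0 ∧ ∃ E : Matrix (Fin n) (Fin n) ℤ, A ^ k = 1 + d • E := by
  have : NeZero d.natAbs := ⟨Int.natAbs_ne_zero.2 hd⟩
  let φ := (Int.castRingHom (ZMod d.natAbs)).mapMatrix (m := Fin n)
  obtain ⟨u, rfl⟩ := hA
  obtain ⟨k, hk, hu⟩ := (isOfFinOrder_of_finite (Units.map φ.toMonoidHom u)).exists_pow_eq_one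
  have hφ : φ ((u : Matrix (Fin n) (Fin n) ℤ) ^ k) = 1 := by
    rw [map_pow]
    simpa using congrArg Units.val hu
  have hdvd : ∀ i j, d ∣ ((u : Matrix (Fin n) (Fin n) ℤ) ^ k - 1) i j := fun i j => by
    have h0 : φ ((u : Matrix (Fin n) (Fin n) ℤ) ^ k - 1) = 0 := by
      rw [map_sub, hφ, map_one, sub_self]
    rw [← Int.natAbs_dvd, ← ZMod.intCast_zmod_eq_zero_iff_dvd]
    exact congrFun (congrFun h0 i) j
  choose E hE using hdvd
  refine ⟨k, hk.ne', Matrix.of E, ?_⟩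
  rw [← sub_eq_iff_eq_add']
  ext i j
  simpa using hE i j

/-- Up to passing to a power, a unimodular integer matrix is conjugated by a nonsingular integer
matrix to a unimodular integer matrix. -/
theorem exists_pow_semiconj {n : ℕ} {A B : Matrix (Fin n) (Fin n) ℤ} (hA : IsUnit A)
    (hB : B.det ≠ 0) :
    ∃ k : ℕ, k ≠ 0 ∧ ∃ C : Matrix (Fin n) (Fin n) ℤ, IsUnit C ∧ C * B = B * A ^ k := by
  obtain ⟨k, hk, E, hE⟩ := exists_pow_eq_one_add_smul hA hB
  have hC : (1 + B * E * B.adjugate) * B = B * A ^ k := by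
    rw [hE, add_mul, mul_add, Matrix.mul_assoc (B * E), Matrix.adjugate_mul,
      Matrix.mul_smul, Matrix.mul_smul, one_mul, mul_one, mul_one]
  refine ⟨k, hk, _, ?_, hC⟩
  have hdet := congrArg Matrix.det hC
  rw [Matrix.det_mul, Matrix.det_mul, mul_comm] at hdet
  rw [Matrix.isUnit_iff_isUnit_det, mul_left_cancel₀ hB hdet, ← Matrix.isUnit_iff_isUnit_det]
  exact hA.pow k

theorem matR_pow_mulVec {n : ℕ} {A : Matrix (Fin n) (Fin n) ℤ} {a : Eucl n} {α : ℝ}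
    (h : (matR A).mulVec a = α • a) (k : ℕ) : (matR (A ^ k)).mulVec a = α ^ k • a := by
  induction k with
  | zero => simp [matR_one]
  | succ k ih =>
    rw [pow_succ, matR_mul, ← Matrix.mulVec_mulVec, h, Matrix.mulVec_smul, ih, smul_smul,
      pow_succ, mul_comm]

/-- if the flow of `a` is algebraic with a multiplier other than `±1`, then for any
integer matrix `B` with `det B ≠ 0`, the flow of `b = B a` also has a multiplier other than
`±1`. -/
theorem stmt_15 (n : ℕ) (hn : 1 ≤ n) (a : Eucl n)
    (ϑ : ℝ) (hϑ : ϑ ≠ 0) (F : Subfield ℝ) (hF : Module.finrank ℚ F = n)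
    (halg : IsAlgebraicFreq a ϑ F)
    (hM : ∃ α ∈ Mgroup a, α ≠ 1 ∧ α ≠ -1)
    (B : Matrix (Fin n) (Fin n) ℤ) (hB : B.det ≠ 0)
    (b : Eucl n) (hb : b = (matR B).mulVec a) :
    ∃ α ∈ Mgroup b, α ≠ 1 ∧ α ≠ -1 := by
  obtain ⟨α, ⟨hα, R, hR⟩, h1, h2⟩ := hM
  obtain ⟨A, hA, hAa⟩ := hR.exists_matrix
  obtain ⟨k, hk, C, hC, hCB⟩ := exists_pow_semiconj hA hB
  have habs : |α| ≠ 1 := fun h => ((abs_eq zero_le_one).1 h).elim h1 h2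
  have hpow : |α ^ k| ≠ 1 := by
    rwa [abs_pow, Ne, pow_eq_one_iff_of_nonneg (abs_nonneg α) hk]
  refine ⟨α ^ k, mem_Mgroup_of_isUnit (pow_ne_zero k hα) hC ?_, fun h => hpow (by simp [h]),
    fun h => hpow (by simp [h])⟩
  rw [hb, Matrix.mulVec_mulVec, ← matR_mul, hCB, matR_mul, ← Matrix.mulVec_mulVec,
    matR_pow_mulVec hAa, Matrix.mulVec_smul]
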